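/- Let q ≥ 2 be an integer and χ a primitive Dirichlet character mod q, σ ∈ [1/2, 1], t real, and T ≥ 2 with |t| ≤ 2T. Define A = Σ_{n ≥ 1} χ(n) n^{−σ−it} e^{−n/(qT)²}. Then L(σ + it, χ) = A + O((qT)^{−1+ε}) for any ε > 0, with an implied constant depending only on ε. -/

import Mathlib

open Complex

namespace SmoothedApprox

lemma norm_gaussSum {N : ℕ} [NeZero N] {χ : DirichletCharacter ℂ N} (hχ : χ.IsPrimitive) :
    ‖gaussSum χ (ZMod.stdAddChar (N := N))‖ ^ 2 = N := by
  have h1 := congrFun (ZMod.dft_dft (N := N) (fun j => χ j)) (1 : ZMod N)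
  have h2 : ZMod.dft (fun j => χ j) = fun k => gaussSum χ ZMod.stdAddChar * χ⁻¹ (-k) := by
    ext k
    exact (hχ.fourierTransform_eq_inv_mul_gaussSum k).trans (mul_comm _ _)
  rw [h2, ZMod.dft_const_mul] at h1
  have h3 : ZMod.dft (fun j => χ⁻¹ (-j)) (1 : ZMod N) = gaussSum χ⁻¹ ZMod.stdAddChar := by
    have := congrFun (ZMod.dft_comp_neg (fun j => χ⁻¹ j)) (1 : ZMod N)
    rw [this]
    have h4 := DirichletCharacter.fourierTransform_eq_gaussSum_mulShift χ⁻¹ (-1)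
    rw [h4, neg_neg, AddChar.mulShift_one]
  have h4 := star_gaussSum_eq χ (ZMod.stdAddChar (N := N))
  have h5 : χ⁻¹ (-1) * gaussSum χ⁻¹ (ZMod.stdAddChar (N := N))⁻¹ =
      gaussSum χ⁻¹ (ZMod.stdAddChar (N := N)) := by
    rw [AddChar.inv_mulShift, ← Units.coe_neg_one]
    exact gaussSum_mulShift χ⁻¹ _ (-1)
  have hsq : χ (-1) * χ (-1) = 1 := by rw [← map_mul]; simp
  have h6 : χ⁻¹ (-1) * χ (-1) = 1 := by
    rw [← MulChar.mul_apply, inv_mul_cancel, MulChar.one_apply (isUnit_one.neg)]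
  simp only [h3, smul_eq_mul] at h1
  have h7 : gaussSum χ (ZMod.stdAddChar (N := N)) * star (gaussSum χ (ZMod.stdAddChar (N := N))) = N := by
    rw [h4]
    rw [← h5] at h1
    linear_combination χ (-1) * h1 - (gaussSum χ (ZMod.stdAddChar (N := N)) *
      gaussSum χ⁻¹ (ZMod.stdAddChar (N := N))⁻¹) * h6 + N * hsq
  have h8 := congrArg norm h7
  rw [norm_mul, norm_star] at h8
  rw [sq, h8]; simp

lemma norm_rootNumber {N : ℕ} [NeZero N] {χ : DirichletCharacter ℂ N} (hχ : χ.IsPrimitive) :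
    ‖DirichletCharacter.rootNumber χ‖ = 1 := by
  have h := norm_gaussSum hχ
  have hN : (0:ℝ) < N := Nat.cast_pos.mpr (Nat.pos_of_ne_zero (NeZero.ne N))
  rw [DirichletCharacter.rootNumber, norm_div, norm_div, norm_pow, norm_I, one_pow, div_one]
  have h2 : ‖((N : ℂ) ^ (1 / 2 : ℂ))‖ = ‖gaussSum χ (ZMod.stdAddChar (N := N))‖ := by
    rw [← ofReal_natCast, Complex.norm_cpow_eq_rpow_re_of_pos hN]
    rw [show (1/2 : ℂ).re = 1/2 by norm_num, ← Real.sqrt_eq_rpow, ← h, Real.sqrt_sq (norm_nonneg _)]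
  rw [h2, div_self]
  intro h0
  rw [h0] at h
  norm_num at h
  exact NeZero.ne N (by exact_mod_cast h.symm)

lemma norm_Gamma_le {s : ℂ} (hs : 0 < s.re) : ‖Gamma s‖ ≤ Real.Gamma s.re := by
  rw [Complex.Gamma_eq_integral hs, Real.Gamma_eq_integral hs, Complex.GammaIntegral]
  refine (MeasureTheory.norm_integral_le_integral_norm _).trans_eq ?_
  refine MeasureTheory.setIntegral_congr_fun measurableSet_Ioi fun x hx => ?_
  simp only [norm_mul]
  rw [Complex.norm_cpow_eq_rpow_re_of_pos hx, Complex.norm_real, Real.norm_eq_abs, abs_of_pos (Real.exp_pos _)]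
  simp

lemma exists_Gamma_bound {a b : ℝ} (ha : 0 < a) : ∃ M : ℝ, 0 < M ∧ ∀ s : ℂ, a ≤ s.re → s.re ≤ b →
    ‖Gamma s‖ ≤ M := by
  have hc : ContinuousOn Real.Gamma (Set.Icc a b) := fun x hx =>
    (Real.differentiableAt_Gamma fun m => by
      have h1 := hx.1
      have h2 : (0:ℝ) ≤ m := Nat.cast_nonneg m
      intro h
      linarith).continuousAt.continuousWithinAt
  obtain ⟨M, hM⟩ := (isCompact_Icc.image_of_continuousOn hc).bddAbove
  refine ⟨max M 1, by positivity, fun s h1 h2 => (norm_Gamma_le (by linarith)).trans ?_⟩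
  exact (hM ⟨s.re, ⟨h1, h2⟩, rfl⟩).trans (le_max_left _ _)

lemma norm_sin_le (z : ℂ) : ‖Complex.sin z‖ ≤ Real.exp |z.im| := by
  rw [Complex.sin, norm_div, norm_mul, norm_I, mul_one]
  have h1 : ‖cexp (-z * I)‖ ≤ Real.exp |z.im| := by
    rw [Complex.norm_exp]; apply Real.exp_le_exp.mpr; simpa using le_abs_self _
  have h2 : ‖cexp (z * I)‖ ≤ Real.exp |z.im| := by
    rw [Complex.norm_exp]; apply Real.exp_le_exp.mpr; simpa using neg_le_abs _
  have := norm_sub_le (cexp (-z * I)) (cexp (z * I))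
  rw [show ‖(2:ℂ)‖ = 2 by norm_num]
  linarith

lemma exists_inv_Gamma_bound : ∃ M : ℝ, 0 < M ∧ ∀ z : ℂ, -1 ≤ z.re → z.re ≤ 3/2 → 1 ≤ |z.im| →
    ‖(Gamma z)⁻¹‖ ≤ M * Real.exp (Real.pi * |z.im|) := by
  obtain ⟨M, hM0, hM⟩ := exists_Gamma_bound (a := 1/2) (b := 3) (by norm_num)
  refine ⟨M, hM0, fun z h1 h2 h3 => ?_⟩
  have hz1 : (1 - z) ≠ 0 := by
    intro h
    have : z.im = 0 := by have := congrArg Complex.im h; simpa using this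
    rw [this] at h3; norm_num at h3
  have hr := Complex.Gamma_mul_Gamma_one_sub z
  have hadd := Complex.Gamma_add_one (1 - z) hz1
  rw [show 1 - z + 1 = 2 - z by ring] at hadd
  have hz2 : 1 ≤ ‖1 - z‖ := by
    refine h3.trans ?_
    have := Complex.abs_im_le_norm (1 - z)
    simpa using this
  have hG := hM (2 - z) (by simp; linarith) (by simp; linarith)
  have hG1 : ‖Gamma (1 - z)‖ ≤ M := by
    rw [hadd, norm_mul] at hG
    exact (le_mul_of_one_le_left (norm_nonneg _) hz2).trans hG
  have hΓz : Gamma z ≠ 0 := by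
    apply Complex.Gamma_ne_zero
    rintro m rfl
    simp at h3; norm_num at h3
  have hsin : Complex.sin (Real.pi * z) ≠ 0 := by
    intro h
    rw [h, div_zero] at hr
    rcases mul_eq_zero.mp hr with h | h
    · exact hΓz h
    · apply Complex.Gamma_ne_zero (s := 1 - z) _ h
      intro m hm
      have := congrArg Complex.im hm
      simp at this
      rw [this] at h3; norm_num at h3
  have hinv : (Gamma z)⁻¹ = Gamma (1 - z) * Complex.sin (Real.pi * z) / Real.pi := by
    have hpi : (Real.pi : ℂ) ≠ 0 := by exact_mod_cast Real.pi_ne_zero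
    have hr' : Gamma z * Gamma (1 - z) * Complex.sin (Real.pi * z) = Real.pi := by
      rw [hr, div_mul_cancel₀ _ hsin]
    rw [eq_div_iff hpi, inv_mul_eq_iff_eq_mul₀ hΓz]
    linear_combination -hr'
  rw [hinv, norm_div, norm_mul]
  have h5 := norm_sin_le (Real.pi * z)
  have h6 : |(Real.pi * z).im| = Real.pi * |z.im| := by
    simp [abs_mul, abs_of_pos Real.pi_pos]
  rw [h6] at h5
  have h7 : ‖(Real.pi : ℂ)‖ = Real.pi := by simp [abs_of_pos Real.pi_pos]
  rw [h7]
  calc _ ≤ ‖Gamma (1 - z)‖ * ‖Complex.sin (Real.pi * z)‖ := 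
        div_le_self (by positivity) (by linarith [Real.pi_gt_three])
    _ ≤ _ := by gcongr

end SmoothedApprox


namespace SmoothedApprox

open MeasureTheory in
lemma mellin_strip_bound {f : ℝ → ℂ} {a b : ℝ} (ha : MellinConvergent f a)
    (hb : MellinConvergent f b) :
    ∃ M : ℝ, ∀ s : ℂ, a ≤ s.re → s.re ≤ b → ‖mellin f s‖ ≤ M := by
  refine ⟨∫ t : ℝ in Set.Ioi 0, (‖(t : ℂ) ^ ((a : ℂ) - 1) • f t‖ + ‖(t : ℂ) ^ ((b : ℂ) - 1) • f t‖),
    fun s h1 h2 => ?_⟩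
  rw [mellin]
  refine norm_integral_le_of_norm_le (ha.norm.add hb.norm) ?_
  refine (ae_restrict_iff' measurableSet_Ioi).mpr (Filter.Eventually.of_forall fun t ht => ?_)
  have ht' : (0:ℝ) < t := ht
  simp only [norm_smul]
  rw [Complex.norm_cpow_eq_rpow_re_of_pos ht', Complex.norm_cpow_eq_rpow_re_of_pos ht',
    Complex.norm_cpow_eq_rpow_re_of_pos ht']
  simp only [sub_re, ofReal_re, one_re]
  rw [← add_mul]
  gcongr
  rcases le_total 1 t with h | h
  · have := Real.rpow_le_rpow_of_exponent_le h (show s.re - 1 ≤ b - 1 by linarith)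
    have := Real.rpow_pos_of_pos ht' (a - 1)
    linarith
  · have := Real.rpow_le_rpow_of_exponent_ge ht' h (show a - 1 ≤ s.re - 1 by linarith)
    have := Real.rpow_pos_of_pos ht' (b - 1)
    linarith

lemma strong_bound {P : WeakFEPair ℂ} (hP : IsStrongFEPair P) (a b : ℝ) :
    ∃ M : ℝ, ∀ s : ℂ, a ≤ s.re → s.re ≤ b → ‖mellin P.f s‖ ≤ M :=
  mellin_strip_bound (hP.hasMellin a).1 (hP.hasMellin b).1

lemma completed_bound {N : ℕ} [NeZero N] (hN : N ≠ 1) {χ : DirichletCharacter ℂ N} (hχ : χ ≠ 1)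
    (a b : ℝ) :
    ∃ M : ℝ, ∀ s : ℂ, a ≤ s.re → s.re ≤ b → ‖DirichletCharacter.completedLFunction χ s‖ ≤ M := by
  have hE : ∀ c : UnitAddCircle, ∃ M : ℝ, ∀ s : ℂ, a ≤ s.re → s.re ≤ b →
      ‖HurwitzZeta.completedHurwitzZetaEven₀ c s‖ ≤ M := by
    intro c
    obtain ⟨M, hM⟩ := strong_bound
      (HurwitzZeta.hurwitzEvenFEPair c).isStrongFEPair_toStrongFEPair (a/2) (b/2)
    refine ⟨M, fun s h1 h2 => ?_⟩
    have := hM (s/2) (by simp; linarith) (by simp; linarith)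
    rw [HurwitzZeta.completedHurwitzZetaEven₀, norm_div]
    refine le_trans (div_le_self (norm_nonneg _) (by norm_num)) this
  have hO : ∀ c : UnitAddCircle, ∃ M : ℝ, ∀ s : ℂ, a ≤ s.re → s.re ≤ b →
      ‖HurwitzZeta.completedHurwitzZetaOdd c s‖ ≤ M := by
    intro c
    obtain ⟨M, hM⟩ := strong_bound (HurwitzZeta.isStrong_hurwitzOddFEPair c) ((a+1)/2) ((b+1)/2)
    refine ⟨M, fun s h1 h2 => ?_⟩
    have := hM ((s+1)/2) (by simp; linarith) (by simp; linarith)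
    rw [HurwitzZeta.completedHurwitzZetaOdd, (HurwitzZeta.isStrong_hurwitzOddFEPair c).Λ_eq, norm_div]
    refine le_trans (div_le_self (norm_nonneg _) (by norm_num)) this
  choose ME hE using hE
  choose MO hO using hO
  have hN0 : (0:ℝ) < N := Nat.cast_pos.mpr (Nat.pos_of_ne_zero (NeZero.ne N))
  have hN1 : (1:ℝ) ≤ N := by exact_mod_cast Nat.pos_of_ne_zero (NeZero.ne N)
  refine ⟨(N:ℝ) ^ (-a) * ∑ j : ZMod N, ME (ZMod.toAddCircle j) +
    (N:ℝ) ^ (-a) * ∑ j : ZMod N, MO (ZMod.toAddCircle j), fun s h1 h2 => ?_⟩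
  have h0 : χ 0 = 0 := χ.map_zero' hN
  have hs : ∑ j, χ j = 0 := χ.sum_eq_zero_of_ne_one hχ
  rw [DirichletCharacter.completedLFunction, ZMod.completedLFunction_eq, h0, hs]
  simp only [mul_zero, zero_div, sub_zero]
  rw [ZMod.completedLFunction₀]
  have hp : ‖(N:ℂ) ^ (-s)‖ ≤ (N:ℝ) ^ (-a) := by
    rw [← ofReal_natCast, Complex.norm_cpow_eq_rpow_re_of_pos hN0]
    exact Real.rpow_le_rpow_of_exponent_le hN1 (by simpa using h1)
  have key : ∀ (F : ZMod N → ℂ) (B : ZMod N → ℝ), (∀ j, ‖F j‖ ≤ B j) →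
      ‖(N:ℂ) ^ (-s) * ∑ j, χ j * F j‖ ≤ (N:ℝ) ^ (-a) * ∑ j, B j := by
    intro F B hFB
    rw [norm_mul]
    gcongr
    refine (norm_sum_le _ _).trans (Finset.sum_le_sum fun j _ => ?_)
    rw [norm_mul]
    exact (mul_le_of_le_one_left (norm_nonneg _) (χ.norm_le_one j)).trans (hFB j)
  exact (norm_add_le _ _).trans (add_le_add (key _ _ fun j => hE _ s h1 h2)
    (key _ _ fun j => hO _ s h1 h2))

lemma norm_LFunction_le {N : ℕ} [NeZero N] (χ : DirichletCharacter ℂ N) {r : ℝ} (hr : 1 < r) {s : ℂ}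
    (hs : r ≤ s.re) : ‖DirichletCharacter.LFunction χ s‖ ≤ ∑' n : ℕ, ‖LSeries.term 1 (r : ℂ) n‖ := by
  rw [DirichletCharacter.LFunction_eq_LSeries χ (by linarith)]
  have hsum : LSeriesSummable 1 (r : ℂ) := by
    apply LSeriesSummable_of_bounded_of_one_lt_re (m := 1) (by simp) (by simpa using hr)
  refine tsum_of_norm_bounded hsum.norm.hasSum fun n => ?_
  refine (LSeries.norm_term_le s (g := 1) ?_).trans (LSeries.norm_term_le_of_re_le_re 1 (by simpa using hs) n)
  simpa using χ.norm_le_one _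

lemma norm_Gammaℝ_conj (s : ℂ) : ‖Gammaℝ (starRingEnd ℂ s)‖ = ‖Gammaℝ s‖ := by
  rw [Gammaℝ_def, Gammaℝ_def, norm_mul, norm_mul, 
    Complex.norm_cpow_eq_rpow_re_of_pos Real.pi_pos, Complex.norm_cpow_eq_rpow_re_of_pos Real.pi_pos]
  have : starRingEnd ℂ s / 2 = starRingEnd ℂ (s / 2) := by rw [map_div₀, Complex.conj_ofNat]
  rw [this, Complex.Gamma_conj, Complex.norm_conj]
  congr 2
  simp [neg_div]

lemma gamma_ratio {u : ℂ} (hu : u ≠ 0) (v : ℂ) (hv : v = starRingEnd ℂ u + 2) :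
    ‖Gammaℝ v‖ ≤ ‖Gammaℝ u‖ * ‖u‖ := by
  have hu' : starRingEnd ℂ u ≠ 0 := by simpa using hu
  rw [hv, Gammaℝ_add_two hu', norm_div, norm_div, norm_mul, norm_Gammaℝ_conj, Complex.norm_conj]
  have h7 : ‖(Real.pi : ℂ)‖ = Real.pi := by simp [abs_of_pos Real.pi_pos]
  rw [h7]
  refine (div_le_self (by positivity) (by linarith [Real.pi_gt_three])).trans ?_
  exact div_le_self (by positivity) (by norm_num)

lemma gammaFactor_inv {N : ℕ} (χ : DirichletCharacter ℂ N) (s : ℂ) :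
    DirichletCharacter.gammaFactor χ⁻¹ s = DirichletCharacter.gammaFactor χ s := by
  have h6 : χ⁻¹ (-1) * χ (-1) = 1 := by
    rw [← MulChar.mul_apply, inv_mul_cancel, MulChar.one_apply (isUnit_one.neg)]
  rcases χ.even_or_odd with h | h
  · have h' : χ⁻¹.Even := by
      have := h6
      rw [h, mul_one] at this
      exact this
    rw [h.gammaFactor_def, h'.gammaFactor_def]
  · have h' : χ⁻¹.Odd := by
      have := h6
      rw [h] at this
      change χ⁻¹ (-1) = -1
      linear_combination -this
    rw [h.gammaFactor_def, h'.gammaFactor_def]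

lemma line_bound {N : ℕ} [NeZero N] (hN : N ≠ 1) {χ : DirichletCharacter ℂ N} (hχ : χ.IsPrimitive)
    {w : ℂ} (hw : w.re = -1/2) :
    ‖DirichletCharacter.LFunction χ w‖ ≤
      N * ‖w + 2‖ * ∑' n : ℕ, ‖LSeries.term 1 ((3/2 : ℝ) : ℂ) n‖ := by
  have hN0 : (0:ℝ) < N := Nat.cast_pos.mpr (Nat.pos_of_ne_zero (NeZero.ne N))
  have hfe := hχ.completedLFunction_one_sub (1 - w)
  rw [sub_sub_cancel] at hfe
  rw [DirichletCharacter.LFunction_eq_completed_div_gammaFactor χ w (.inr hN), hfe]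
  have h1 := DirichletCharacter.LFunction_eq_completed_div_gammaFactor χ⁻¹ (1 - w) (.inr hN)
  have hZ := norm_LFunction_le χ⁻¹ (r := 3/2) (by norm_num) (s := 1 - w) (by simp [hw]; norm_num)
  rw [h1, gammaFactor_inv] at hZ
  set Z := ∑' n : ℕ, ‖LSeries.term 1 ((3/2 : ℝ) : ℂ) n‖ with hZdef
  have hp : ‖(N:ℂ) ^ (1 - w - 1/2)‖ = (N:ℝ) := by
    rw [← ofReal_natCast, Complex.norm_cpow_eq_rpow_re_of_pos hN0]
    have : (1 - w - 1/2).re = 1 := by simp [hw]; norm_num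
    rw [this, Real.rpow_one]
  have hg : ‖DirichletCharacter.gammaFactor χ (1 - w)‖ ≤
      ‖DirichletCharacter.gammaFactor χ w‖ * ‖w + 2‖ ∧
      DirichletCharacter.gammaFactor χ (1 - w) ≠ 0 := by
    have hle : ∀ x : ℝ, 0 ≤ x → x ≤ 1 → ‖w + x‖ ≤ ‖w + 2‖ := by
      intro x hx hx1
      rw [← Real.sqrt_sq (norm_nonneg (w + x)), ← Real.sqrt_sq (norm_nonneg (w + 2))]
      apply Real.sqrt_le_sqrt
      rw [← Complex.normSq_eq_norm_sq, ← Complex.normSq_eq_norm_sq, Complex.normSq_apply,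
        Complex.normSq_apply]
      simp [hw]
      nlinarith
    rcases χ.even_or_odd with h | h
    · rw [h.gammaFactor_def, h.gammaFactor_def]
      refine ⟨(gamma_ratio (u := w) ?_ _ ?_).trans ?_, ?_⟩
      · intro h; rw [h] at hw; norm_num at hw
      · apply Complex.ext <;> simp [hw]; norm_num
      · have := hle 0 le_rfl zero_le_one
        gcongr
        simpa using this
      · exact Gammaℝ_ne_zero_of_re_pos (by simp [hw]; norm_num)
    · rw [h.gammaFactor_def, h.gammaFactor_def]
      refine ⟨(gamma_ratio (u := w + 1) ?_ _ ?_).trans ?_, ?_⟩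
      · intro h; have := congrArg Complex.re h; simp [hw] at this; norm_num at this
      · apply Complex.ext <;> simp [hw]; norm_num
      · have := hle 1 zero_le_one le_rfl
        gcongr
        simpa using this
      · exact Gammaℝ_ne_zero_of_re_pos (by simp [hw]; norm_num)
  rw [norm_div, norm_mul, norm_mul, hp, norm_rootNumber hχ, mul_one]
  rw [norm_div, div_le_iff₀ (norm_pos_iff.mpr hg.2)] at hZ
  have hZ0 : 0 ≤ Z := tsum_nonneg fun n => norm_nonneg _
  apply div_le_of_le_mul₀ (norm_nonneg _) (by positivity)
  calc (N:ℝ) * ‖DirichletCharacter.completedLFunction χ⁻¹ (1 - w)‖ 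
      ≤ N * (Z * (‖DirichletCharacter.gammaFactor χ w‖ * ‖w + 2‖)) := by
        gcongr
        exact hZ.trans (by gcongr; exact hg.1)
    _ = _ := by ring

end SmoothedApprox


namespace SmoothedApprox

lemma exists_inv_Gammaℝ_bound : ∃ M : ℝ, 0 < M ∧ ∀ u : ℂ, -1 ≤ u.re → u.re ≤ 3 → 2 ≤ |u.im| →
    ‖(Gammaℝ u)⁻¹‖ ≤ M * Real.exp (Real.pi * |u.im|) := by
  obtain ⟨M, hM0, hM⟩ := exists_inv_Gamma_bound
  refine ⟨Real.pi ^ (3/2 : ℝ) * M, by positivity, fun u h1 h2 h3 => ?_⟩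
  have him : |(u/2).im| = |u.im| / 2 := by simp [abs_div]
  have h4 := hM (u/2) (by simp; linarith) (by simp; linarith) (by rw [him]; linarith)
  rw [him] at h4
  rw [Gammaℝ_def, mul_inv, norm_mul, norm_inv, Complex.norm_cpow_eq_rpow_re_of_pos Real.pi_pos,
    ← Real.rpow_neg Real.pi_pos.le, mul_assoc]
  have hpi : 1 ≤ Real.pi := by linarith [Real.pi_gt_three]
  gcongr
  · simp; linarith
  · refine h4.trans ?_
    gcongr
    linarith [abs_nonneg u.im]

lemma growth {N : ℕ} [NeZero N] (hN : N ≠ 1) {χ : DirichletCharacter ℂ N} (hχ : χ ≠ 1) :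
    ∃ K : ℝ, ∀ z : ℂ, -1/2 ≤ z.re → z.re ≤ 2 → 2 ≤ |z.im| → 
      ‖DirichletCharacter.LFunction χ z‖ ≤ K * Real.exp (Real.pi * |z.im|) := by
  obtain ⟨M, hM⟩ := completed_bound hN hχ (-1/2) 2
  obtain ⟨M', hM0, hM'⟩ := exists_inv_Gammaℝ_bound
  refine ⟨M * M', fun z h1 h2 h3 => ?_⟩
  rw [DirichletCharacter.LFunction_eq_completed_div_gammaFactor χ z (.inr hN), div_eq_mul_inv,
    norm_mul, mul_assoc]
  have hg : ‖(DirichletCharacter.gammaFactor χ z)⁻¹‖ ≤ M' * Real.exp (Real.pi * |z.im|) := by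
    rcases χ.even_or_odd with h | h
    · rw [h.gammaFactor_def]
      exact hM' z (by linarith) (by linarith) h3
    · rw [h.gammaFactor_def]
      have := hM' (z+1) (by simp; linarith) (by simp; linarith) (by simpa using h3)
      simpa using this
  have h5 := hM z h1 h2
  have h6 : 0 ≤ M := (norm_nonneg _).trans h5
  gcongr

lemma ne_one {N : ℕ} [NeZero N] (hN : N ≠ 1) {χ : DirichletCharacter ℂ N} (hχ : χ.IsPrimitive) :
    χ ≠ 1 := by
  intro h
  rw [DirichletCharacter.IsPrimitive, h, DirichletCharacter.conductor_one] at hχ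
  · exact hN hχ.symm

lemma strip_bound : ∃ C : ℝ, 0 < C ∧ ∀ (N : ℕ) [NeZero N], 2 ≤ N → ∀ χ : DirichletCharacter ℂ N,
    χ.IsPrimitive → ∀ w : ℂ, -1/2 ≤ w.re → w.re ≤ 2 →
    ‖DirichletCharacter.LFunction χ w‖ ≤ C * N * ‖w + 2‖ := by
  set Z := ∑' n : ℕ, ‖LSeries.term 1 ((3/2 : ℝ) : ℂ) n‖ with hZdef
  have hZ0 : 0 ≤ Z := tsum_nonneg fun n => norm_nonneg _
  refine ⟨Z + 1, by positivity, fun N _ hN2 χ hχ w h1 h2 => ?_⟩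
  have hN : N ≠ 1 := by omega
  have hχ1 := ne_one hN hχ
  have hN1 : (1:ℝ) ≤ N := by exact_mod_cast Nat.pos_of_ne_zero (NeZero.ne N)
  have hne : ∀ z : ℂ, -1/2 ≤ z.re → 1 ≤ ‖z + 2‖ := by
    intro z hz
    have := Complex.re_le_norm (z + 2)
    simp at this
    linarith
  have hne0 : ∀ z : ℂ, -1/2 ≤ z.re → z + 2 ≠ 0 := fun z hz h => by
    have := hne z hz
    rw [h] at this; norm_num at this
  have main : ‖DirichletCharacter.LFunction χ w / (w + 2)‖ ≤ (Z + 1) * N := by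
    refine PhragmenLindelof.vertical_strip (a := -1/2) (b := 2)
      (f := fun w => DirichletCharacter.LFunction χ w / (w + 2)) ?_ ?_ ?_ ?_ h1 h2
    · apply DifferentiableOn.diffContOnCl
      intro z hz
      have hz' : z ∈ Complex.re ⁻¹' (Set.Icc (-1/2) 2) := by
        refine closure_minimal (Set.preimage_mono Set.Ioo_subset_Icc_self)
          (isClosed_Icc.preimage Complex.continuous_re) hz
      refine (DifferentiableAt.div (DirichletCharacter.differentiable_LFunction hχ1 z) (by fun_prop)
        (hne0 z hz'.1)).differentiableWithinAt
    · refine ⟨1, ?_, Real.pi, ?_⟩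
      · rw [lt_div_iff₀ (by norm_num)]
        linarith [Real.pi_gt_three]
      · obtain ⟨K, hK⟩ := growth hN hχ1
        refine Asymptotics.IsBigO.of_bound K ?_
        rw [Filter.eventually_inf_principal]
        have : ∀ᶠ z : ℂ in Filter.comap (_root_.abs ∘ Complex.im) Filter.atTop, 2 ≤ |z.im| :=
          Filter.tendsto_comap.eventually (Filter.eventually_ge_atTop 2)
        filter_upwards [this] with z hz hzr
        have h5 := hK z hzr.1.le hzr.2.le hz
        have hK0 : 0 ≤ K := by
          by_contra h
          push Not at h
          have := mul_neg_of_neg_of_pos h (Real.exp_pos (Real.pi * |z.im|))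
          linarith [norm_nonneg (DirichletCharacter.LFunction χ z)]
        rw [norm_div, Real.norm_eq_abs, abs_of_pos (Real.exp_pos _)]
        refine (div_le_self (norm_nonneg _) (hne z hzr.1.le)).trans (h5.trans ?_)
        gcongr
        rw [one_mul]
        linarith [Real.add_one_le_exp |z.im|]
    · intro z hz
      have h5 := line_bound hN hχ hz
      rw [norm_div]
      have h6 := hne z hz.ge
      apply div_le_of_le_mul₀ (norm_nonneg _) (by positivity)
      refine h5.trans ?_
      rw [← hZdef]
      have : 0 ≤ (N:ℝ) * ‖z + 2‖ := by positivity
      nlinarith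
    · intro z hz
      have h5 := norm_LFunction_le χ (r := 3/2) (by norm_num) (s := z) (by rw [hz]; norm_num)
      rw [norm_div]
      refine (div_le_self (norm_nonneg _) (hne z (by rw [hz]; norm_num))).trans (h5.trans ?_)
      rw [← hZdef]
      nlinarith
  rw [norm_div, div_le_iff₀ (by linarith [hne w h1])] at main
  exact main

/-- decay of the Gamma function -/
lemma exists_Gamma_decay {d : ℝ} (hd1 : d < 1) : ∃ M : ℝ, 0 < M ∧ ∀ s : ℂ,
    -d ≤ s.re → s.re ≤ d → ‖Gamma (s + 1)‖ ≤ M / (1 + s.im ^ 2) ^ 2 := by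
  obtain ⟨M, hM0, hM⟩ := exists_Gamma_bound (a := 4) (b := 6) (by norm_num)
  refine ⟨M / (1 - d) ^ 4, by have : 0 < 1 - d := by linarith
                              positivity, fun s h1 h2 => ?_⟩
  have hd0 : 0 < 1 - d := by linarith
  have hne : ∀ x : ℝ, 1 ≤ x → s + x ≠ 0 := by
    intro x hx h
    have := congrArg Complex.re h
    simp at this
    linarith
  have e1 := Complex.Gamma_add_one (s + 1) (by simpa using hne 1 le_rfl)
  have e2 := Complex.Gamma_add_one (s + 2) (by simpa using hne 2 (by norm_num))
  have e3 := Complex.Gamma_add_one (s + 3) (by simpa using hne 3 (by norm_num))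
  have e4 := Complex.Gamma_add_one (s + 4) (by simpa using hne 4 (by norm_num))
  rw [show s + 1 + 1 = s + 2 by ring] at e1
  rw [show s + 2 + 1 = s + 3 by ring] at e2
  rw [show s + 3 + 1 = s + 4 by ring] at e3
  rw [show s + 4 + 1 = s + 5 by ring] at e4
  have h5 := hM (s + 5) (by simp; linarith) (by simp; linarith)
  rw [e4, e3, e2, e1] at h5
  simp only [norm_mul] at h5
  have hlow : ∀ x : ℝ, 1 ≤ x → (1 - d) * Real.sqrt (1 + s.im ^ 2) ≤ ‖s + x‖ := by
    intro x hx
    apply le_of_sq_le_sq _ (norm_nonneg _)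
    rw [mul_pow, Real.sq_sqrt (by positivity), ← Complex.normSq_eq_norm_sq, Complex.normSq_apply]
    simp
    have hdd : 0 ≤ d := by linarith
    have a1 : (1 - d) ^ 2 ≤ (s.re + x) ^ 2 := pow_le_pow_left₀ hd0.le (by linarith) 2
    have a2 : (1 - d) ^ 2 * s.im ^ 2 ≤ 1 * s.im ^ 2 :=
      mul_le_mul_of_nonneg_right (pow_le_one₀ hd0.le (by linarith)) (sq_nonneg _)
    nlinarith
  have l1 := hlow 1 le_rfl
  have l2 := hlow 2 (by norm_num)
  have l3 := hlow 3 (by norm_num)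
  have l4 := hlow 4 (by norm_num)
  push_cast at l1 l2 l3 l4
  set R := (1 - d) * Real.sqrt (1 + s.im ^ 2) with hR
  have hR0 : 0 < R := by positivity
  have hR4 : R ^ 4 = (1 - d) ^ 4 * (1 + s.im ^ 2) ^ 2 := by
    rw [hR, mul_pow]
    congr 1
    rw [show 4 = 2 * 2 by norm_num, pow_mul, Real.sq_sqrt (by positivity)]
  rw [div_div, ← hR4, le_div_iff₀ (by positivity)]
  refine le_trans ?_ h5
  calc ‖Gamma (s + 1)‖ * R ^ 4 = R * (R * (R * (R * ‖Gamma (s + 1)‖))) := by ring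
    _ ≤ _ := by gcongr

end SmoothedApprox


namespace SmoothedApprox

open MeasureTheory Filter Topology

lemma vertical_integrable {G : ℂ → ℂ} {d M c : ℝ} (hd : 0 < d) (hc : |c| = d)
    (hG : ∀ s : ℂ, -d ≤ s.re → s.re ≤ d → DifferentiableAt ℂ G s)
    (hb : ∀ s : ℂ, -d ≤ s.re → s.re ≤ d → ‖G s‖ ≤ M / (1 + s.im ^ 2)) :
    Integrable (fun y : ℝ => G (c + y * I) / (c + y * I)) ∧
    ∀ y : ℝ, ‖G (c + y * I) / (c + y * I)‖ ≤ M / d * (1 + y ^ 2)⁻¹ := by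
  have h1 : -d ≤ c := by rw [← hc]; exact neg_abs_le c
  have h2 : c ≤ d := by rw [← hc]; exact le_abs_self c
  have hn : ∀ y : ℝ, d ≤ ‖(c : ℂ) + y * I‖ := fun y => by
    have := Complex.abs_re_le_norm ((c : ℂ) + y * I)
    simpa [hc] using this
  have hbd : ∀ y : ℝ, ‖G (c + y * I) / (c + y * I)‖ ≤ M / d * (1 + y ^ 2)⁻¹ := by
    intro y
    have h3 := hb (c + y * I) (by simpa using h1) (by simpa using h2)
    simp only [add_im, ofReal_im, mul_im, ofReal_re, I_im, mul_one, I_re, mul_zero, zero_add, add_zero] at h3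
    rw [norm_div, show M / d * (1 + y ^ 2)⁻¹ = (M / (1 + y ^ 2)) / d by field_simp]
    exact div_le_div₀ ((norm_nonneg _).trans h3) h3 hd (hn y)
  refine ⟨?_, hbd⟩
  refine (integrable_inv_one_add_sq.const_mul (M / d)).mono' ?_ (Eventually.of_forall hbd)
  apply Continuous.aestronglyMeasurable
  rw [continuous_iff_continuousAt]
  intro y
  have hGc := (hG (c + y * I) (by simpa using h1) (by simpa using h2)).continuousAt
  have hl : ContinuousAt (fun y : ℝ => (c : ℂ) + y * I) y := by fun_prop
  refine ContinuousAt.div (ContinuousAt.comp (f := fun y : ℝ => (c : ℂ) + y * I) hGc hl) hl ?_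
  rw [← norm_pos_iff]
  exact hd.trans_le (hn y)

lemma kernel_integral {d : ℝ} (hd : 0 < d) :
    Integrable (fun y : ℝ => 2 * d / (d ^ 2 + y ^ 2)) ∧ ∫ y : ℝ, 2 * d / (d ^ 2 + y ^ 2) = 2 * Real.pi := by
  have he : (fun y : ℝ => 2 * d / (d ^ 2 + y ^ 2)) = fun y => (2 / d) * (1 + (y / d) ^ 2)⁻¹ := by
    ext y
    field_simp
  rw [he]
  refine ⟨(integrable_inv_one_add_sq.comp_div hd.ne').const_mul _, ?_⟩
  rw [integral_const_mul, Measure.integral_comp_div (fun y : ℝ => (1 + y ^ 2)⁻¹) d,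
    integral_univ_inv_one_add_sq, abs_of_pos hd, smul_eq_mul]
  field_simp

lemma contour {G : ℂ → ℂ} {d M : ℝ} (hd : 0 < d)
    (hG : ∀ s : ℂ, -d ≤ s.re → s.re ≤ d → DifferentiableAt ℂ G s)
    (hb : ∀ s : ℂ, -d ≤ s.re → s.re ≤ d → ‖G s‖ ≤ M / (1 + s.im ^ 2)) :
    (∫ y : ℝ, G (d + y * I) / (d + y * I)) - ∫ y : ℝ, G ((-d : ℝ) + y * I) / ((-d : ℝ) + y * I)
      = 2 * Real.pi * G 0 := by
  obtain ⟨i1, -⟩ := vertical_integrable (c := d) hd (abs_of_pos hd) hG hb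
  obtain ⟨i2, -⟩ := vertical_integrable (c := -d) hd (by rw [abs_neg, abs_of_pos hd]) hG hb
  obtain ⟨k1, k2⟩ := kernel_integral hd
  have hM : 0 ≤ M := by
    have := (norm_nonneg _).trans (hb 0 (by simpa using hd.le) (by simpa using hd.le))
    simpa using this
  set h : ℝ → ℂ := fun y => G (d + y * I) / (d + y * I) - G ((-d : ℝ) + y * I) / ((-d : ℝ) + y * I)
    - ((2 * d / (d ^ 2 + y ^ 2) : ℝ) : ℂ) * G 0 with hh
  have k1' : Integrable (fun y : ℝ => ((2 * d / (d ^ 2 + y ^ 2) : ℝ) : ℂ)) := k1.ofReal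
  have hi : Integrable h := (i1.sub i2).sub (k1.ofReal.mul_const _)
  have hint : ∫ y, h y = (∫ y : ℝ, G (d + y * I) / (d + y * I)) -
      (∫ y : ℝ, G ((-d : ℝ) + y * I) / ((-d : ℝ) + y * I)) - 2 * Real.pi * G 0 := by
    have e1 := integral_sub (i1.sub i2) (k1'.mul_const (G 0))
    have e2 := integral_sub i1 i2
    simp only [Pi.sub_apply] at e1
    simp only [hh]
    rw [e1, e2, integral_mul_const, integral_complex_ofReal, k2]
    push_cast
    rfl
  suffices ∫ y, h y = 0 by
    rw [hint] at this
    exact sub_eq_zero.mp this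
  have t1 := intervalIntegral_tendsto_integral hi tendsto_neg_atTop_atBot tendsto_id
  set H := dslope G 0 with hH
  have Hne : ∀ s : ℂ, s ≠ 0 → H s = (G s - G 0) / s := by
    intro s hs
    rw [hH, dslope_of_ne _ hs, slope_def_field, sub_zero]
  have hhH : ∀ y : ℝ, h y = H (d + y * I) - H ((-d : ℝ) + y * I) := by
    intro y
    have n1 : (d : ℂ) + y * I ≠ 0 := by
      intro h; have := congrArg Complex.re h; simp at this; linarith
    have n2 : ((-d : ℝ) : ℂ) + y * I ≠ 0 := by
      intro h; have := congrArg Complex.re h; simp at this; linarith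
    rw [hh, Hne _ n1, Hne _ n2]
    have n3 : (d : ℂ) ^ 2 + (y : ℂ) ^ 2 ≠ 0 := by
      have : d ^ 2 + y ^ 2 ≠ 0 := by positivity
      exact_mod_cast this
    push_cast at n2 ⊢
    have hker : 2 * (d : ℂ) / (d ^ 2 + y ^ 2) = 1 / (d + y * I) - 1 / (-d + y * I) := by
      rw [div_sub_div _ _ n1 n2, div_eq_div_iff n3 (mul_ne_zero n1 n2)]
      linear_combination (2 * (d:ℂ) * y ^ 2) * I_sq
    rw [hker]
    ring
  have hrect : ∀ R : ℝ, 0 < R → ‖∫ y in (-R)..R, h y‖ ≤ 2 * ((M + ‖G 0‖) / R * (2 * d)) := by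
    intro R hR
    have hdiff : DifferentiableOn ℂ H (Set.uIcc (-d) d ×ℂ Set.uIcc (-R) R) := by
      rw [hH, Complex.differentiableOn_dslope]
      · intro s hs
        rw [Complex.mem_reProdIm, Set.uIcc_of_le (by linarith : -d ≤ d)] at hs
        exact (hG s hs.1.1 hs.1.2).differentiableWithinAt
      · rw [Set.uIcc_of_le (by linarith : -d ≤ d), Set.uIcc_of_le (by linarith : -R ≤ R)]
        exact Filter.inter_mem
          (Complex.continuous_re.continuousAt.preimage_mem_nhds (Icc_mem_nhds (by simpa using hd) (by simpa using hd)))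
          (Complex.continuous_im.continuousAt.preimage_mem_nhds (Icc_mem_nhds (by simpa using hR) (by simpa using hR)))
    have hr := Complex.integral_boundary_rect_eq_zero_of_differentiableOn H (⟨-d, -R⟩ : ℂ) ⟨d, R⟩ hdiff
    simp only [smul_eq_mul] at hr
    have hv : ∀ c : ℝ, c ∈ Set.Icc (-d) d → IntervalIntegrable (fun y : ℝ => H (c + y * I)) volume (-R) R := by
      intro c hc
      apply ContinuousOn.intervalIntegrable
      refine hdiff.continuousOn.comp (f := fun y : ℝ => (c:ℂ) + y * I) (by fun_prop) ?_
      intro y hy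
      rw [Complex.mem_reProdIm, Set.uIcc_of_le (by linarith : -d ≤ d)]
      simpa using ⟨hc, hy⟩
    have hsplit : ∫ y in (-R)..R, h y = (∫ y in (-R)..R, H (d + y * I)) - ∫ y in (-R)..R, H ((-d : ℝ) + y * I) := by
      rw [← intervalIntegral.integral_sub (hv d ⟨by linarith, le_rfl⟩) (hv (-d) ⟨le_rfl, by linarith⟩)]
      exact intervalIntegral.integral_congr fun y _ => hhH y
    have hhor : ∀ r : ℝ, |r| = R → ‖∫ x in (-d)..d, H (x + r * I)‖ ≤ (M + ‖G 0‖) / R * (2 * d) := by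
      intro r hr
      have := intervalIntegral.norm_integral_le_of_norm_le_const (a := -d) (b := d)
        (f := fun x : ℝ => H (x + r * I)) (C := (M + ‖G 0‖) / R) ?_
      · rwa [show d - -d = 2 * d by ring, abs_of_pos (by linarith)] at this
      · intro x hx
        rw [Set.uIoc_of_le (by linarith)] at hx
        have hn : R ≤ ‖(x : ℂ) + r * I‖ := by
          have := Complex.abs_im_le_norm ((x : ℂ) + r * I)
          simpa [hr] using this
        have hne : (x : ℂ) + r * I ≠ 0 := by
          rw [← norm_pos_iff]; linarith
        rw [Hne _ hne, norm_div]
        refine div_le_div₀ (by positivity) ?_ hR hn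
        refine (norm_sub_le _ _).trans ?_
        gcongr
        refine (hb _ (by simpa using hx.1.le) (by simpa using hx.2)).trans ?_
        exact div_le_self hM (by nlinarith [sq_nonneg ((x : ℂ) + r * I).im])
    have hI : I * (∫ y in (-R)..R, h y) = (∫ x in (-d)..d, H (x + R * I)) - ∫ x in (-d)..d, H (x + (-R : ℝ) * I) := by
      rw [hsplit]
      linear_combination hr
    have := congrArg norm hI
    rw [norm_mul, norm_I, one_mul] at this
    rw [this]
    refine (norm_sub_le _ _).trans ?_
    have a1 := hhor R (abs_of_pos hR)
    have a2 := hhor (-R) (by rw [abs_neg, abs_of_pos hR])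
    linarith
  have t2 : Tendsto (fun R : ℝ => ∫ y in (-R)..R, h y) atTop (𝓝 0) := by
    apply squeeze_zero_norm' (a := fun R => 2 * ((M + ‖G 0‖) / R * (2 * d)))
    · filter_upwards [eventually_gt_atTop 0] with R hR using hrect R hR
    · have := ((tendsto_const_nhds (x := M + ‖G 0‖)).div_atTop tendsto_id).mul_const (2 * d)
      have := this.const_mul 2
      simpa using this
  exact tendsto_nhds_unique t1 t2

end SmoothedApprox


namespace SmoothedApprox

open MeasureTheory Filter Topology

lemma gamma_vertical {d : ℝ} (hd : 0 < d) (hd1 : d < 1) :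
    Integrable (fun y : ℝ => Gamma (d + y * I)) := by
  obtain ⟨M, hM, h⟩ := exists_Gamma_decay hd1
  have hg := (vertical_integrable (G := fun s => Gamma (s + 1)) (c := d) (M := M) hd (abs_of_pos hd) ?_ ?_).1
  · refine hg.congr (Eventually.of_forall fun y => ?_)
    have n1 : (d : ℂ) + y * I ≠ 0 := by
      intro h; have := congrArg Complex.re h; simp at this; linarith
    simp only
    rw [Gamma_add_one _ n1]
    field_simp
  · intro s h1 h2
    have : DifferentiableAt ℂ Gamma (s + 1) := by
      apply differentiableAt_Gamma
      intro m hm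
      have := congrArg Complex.re hm
      simp at this
      have : (0:ℝ) ≤ m := m.cast_nonneg
      linarith
    exact this.comp s (by fun_prop)
  · intro s h1 h2
    refine (h s h1 h2).trans ?_
    gcongr
    nlinarith [sq_nonneg s.im]

lemma gamma_inv {d x : ℝ} (hd : 0 < d) (hd1 : d < 1) (hx : 0 < x) :
    ∫ y : ℝ, (x : ℂ) ^ (-((d : ℂ) + y * I)) * Gamma (d + y * I) = 2 * Real.pi * Real.exp (-x) := by
  have hG : ∀ y : ℝ, mellin (fun x : ℝ => ((Real.exp (-x) : ℝ) : ℂ)) (d + y * I) = Gamma (d + y * I) := by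
    intro y
    rw [← GammaIntegral_eq_mellin, Gamma_eq_integral]
    simpa using hd
  have := mellinInv_mellin_eq d (fun x : ℝ => ((Real.exp (-x) : ℝ) : ℂ)) hx ?_ ?_ ?_
  · rw [mellinInv] at this
    simp only [hG, smul_eq_mul] at this
    rw [← this, Complex.real_smul]
    have : (Real.pi : ℂ) ≠ 0 := by exact_mod_cast Real.pi_ne_zero
    push_cast
    field_simp
    simp only [mul_comm I]
  · have := GammaIntegral_convergent (s := d) (by simpa using hd)
    rw [MellinConvergent]
    simpa [mul_comm] using this
  · rw [VerticalIntegrable]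
    simp only [hG]
    exact gamma_vertical hd hd1
  · fun_prop

lemma right_line {q : ℕ} [NeZero q] (hq : 2 ≤ q) (χ : DirichletCharacter ℂ q) {d X : ℝ} (hd : 0 < d)
    (hd1 : d < 1) {s₀ : ℂ} (h : 1 < s₀.re + d) (hX : 0 < X) :
    ∫ y : ℝ, Gamma (d + y * I + 1) * (X : ℂ) ^ ((d : ℂ) + y * I) *
        DirichletCharacter.LFunction χ (s₀ + (d + y * I)) / (d + y * I) =
      2 * Real.pi * ∑' n : ℕ, χ (n : ZMod q) * (n : ℂ) ^ (-s₀) * (Real.exp (-((n : ℝ) / X)) : ℂ) := by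
  have hXc : (X : ℂ) ≠ 0 := by exact_mod_cast hX.ne'
  set c : ℂ := s₀ + d with hc
  have hcre : 1 < c.re := by simpa [hc] using h
  set F : ℕ → ℝ → ℂ := fun n y => LSeries.term (fun n => χ n) (s₀ + (d + y * I)) n *
    ((X : ℂ) ^ ((d : ℂ) + y * I) * Gamma (d + y * I)) with hF
  have hgi : Integrable (fun y : ℝ => (X : ℂ) ^ ((d : ℂ) + y * I) * Gamma (d + y * I)) := by
    refine (gamma_vertical hd hd1).bdd_mul (c := X ^ d) ?_ (Eventually.of_forall fun y => ?_)
    · apply Continuous.aestronglyMeasurable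
      exact Continuous.const_cpow (by fun_prop) (Or.inl hXc)
    · rw [norm_cpow_eq_rpow_re_of_pos hX]
      simp
  have hterm : ∀ (n : ℕ) (y : ℝ), ‖LSeries.term (fun n => χ n) (s₀ + (d + y * I)) n‖ =
      ‖LSeries.term (fun n => χ n) c n‖ := by
    intro n y
    rw [LSeries.norm_term_eq, LSeries.norm_term_eq]
    simp [hc]
  have hFi : ∀ n, Integrable (F n) := by
    intro n
    refine hgi.bdd_mul (c := ‖LSeries.term (fun n => χ n) c n‖) ?_ (Eventually.of_forall fun y => (hterm n y).le)
    apply Continuous.aestronglyMeasurable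
    rcases eq_or_ne n 0 with rfl | hn
    · simp only [LSeries.term_zero]; fun_prop
    · simp only [LSeries.term_of_ne_zero hn]
      have : (n : ℂ) ≠ 0 := by exact_mod_cast hn
      refine Continuous.div (by fun_prop) (Continuous.const_cpow (by fun_prop) (Or.inl this)) ?_
      intro y
      simp [cpow_eq_zero_iff, this]
  have hFs : Summable fun n => ∫ y, ‖F n y‖ := by
    have hs : LSeriesSummable (fun n => χ n) c := DirichletCharacter.LSeriesSummable_of_one_lt_re χ hcre
    refine (hs.norm.mul_right (∫ y : ℝ, ‖(X : ℂ) ^ ((d : ℂ) + y * I) * Gamma (d + y * I)‖)).congr fun n => ?_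
    rw [← integral_const_mul]
    refine integral_congr_ae (Eventually.of_forall fun y => ?_)
    simp only [hF, norm_mul, hterm]
  have hsum := hasSum_integral_of_summable_integral_norm hFi hFs
  have e1 : ∫ y : ℝ, Gamma (d + y * I + 1) * (X : ℂ) ^ ((d : ℂ) + y * I) *
        DirichletCharacter.LFunction χ (s₀ + (d + y * I)) / (d + y * I) = ∫ y, ∑' n, F n y := by
    refine integral_congr_ae (Eventually.of_forall fun y => ?_)
    have n1 : (d : ℂ) + y * I ≠ 0 := by
      intro h; have := congrArg Complex.re h; simp at this; linarith
    simp only [hF]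
    rw [tsum_mul_right, DirichletCharacter.LFunction_eq_LSeries χ (by simpa using h), LSeries,
      Gamma_add_one _ n1]
    field_simp
  rw [e1, ← hsum.tsum_eq, ← tsum_mul_left]
  refine tsum_congr fun n => ?_
  rcases eq_or_ne n 0 with rfl | hn
  · have : χ ((0:ℕ) : ZMod q) = 0 := by
      rw [Nat.cast_zero]; exact χ.map_zero' (by omega)
    rw [this]
    simp [hF]
  · have hnp : (0:ℝ) < n := by exact_mod_cast Nat.pos_of_ne_zero hn
    have hnc : (n : ℂ) ≠ 0 := by exact_mod_cast hn
    have := gamma_inv hd hd1 (div_pos hnp hX)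
    rw [mul_left_comm, ← this, ← integral_const_mul]
    refine integral_congr_ae (Eventually.of_forall fun y => ?_)
    simp only [hF]
    rw [LSeries.term_of_ne_zero hn, ofReal_div]
    have hdiv : ((n : ℝ) / X : ℂ) ^ (-((d : ℂ) + y * I)) =
        (n : ℂ) ^ (-((d : ℂ) + y * I)) * (X : ℂ) ^ ((d : ℂ) + y * I) := by
      rw [← ofReal_div, div_eq_mul_inv, ofReal_mul, mul_cpow_ofReal_nonneg hnp.le (by positivity),
        ofReal_inv, inv_cpow _ _ (by rw [arg_ofReal_of_nonneg hX.le]; exact Real.pi_pos.ne), cpow_neg (X : ℂ), inv_inv]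
      simp
    rw [hdiv, div_eq_mul_inv, ← cpow_neg, neg_add, cpow_add _ _ hnc]
    ring

lemma pointwise {e : ℝ} (he : 0 < e) (he4 : e ≤ 1 / 4) :
    ∃ K : ℝ, 0 < K ∧ ∀ (q : ℕ) [NeZero q], 2 ≤ q →
      ∀ χ : DirichletCharacter ℂ q, χ.IsPrimitive →
      ∀ σ t T X : ℝ, 1 / 2 ≤ σ → σ ≤ 1 → 2 ≤ T → |t| ≤ 2 * T → 0 < X →
      ∀ s : ℂ, -(1 - e) ≤ s.re → s.re ≤ 1 - e →
      ‖Gamma (s + 1) * (X : ℂ) ^ s * DirichletCharacter.LFunction χ ((σ + I * t) + s)‖ ≤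
        K * (q * T) * X ^ s.re / (1 + s.im ^ 2) := by
  obtain ⟨C, hC, hL⟩ := strip_bound
  obtain ⟨M, hM, hΓ⟩ := exists_Gamma_decay (d := 1 - e) (by linarith)
  refine ⟨5 * M * C, by positivity, ?_⟩
  intro q _ hq χ hχ σ t T X h1 h2 hT ht hX s hs1 hs2
  have b1 := hΓ s hs1 hs2
  have b2 := hL q hq χ hχ ((σ + I * t) + s) (by simp; linarith) (by simp; linarith)
  have b3 : ‖((σ : ℂ) + I * t) + s + 2‖ ≤ 5 * T * (1 + s.im ^ 2) := by
    have h3 := Complex.norm_le_abs_re_add_abs_im (((σ : ℂ) + I * t) + s + 2)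
    have hre : |(((σ : ℂ) + I * t) + s + 2).re| ≤ 4 := by
      simp
      rw [abs_le]; constructor <;> linarith
    have him : |(((σ : ℂ) + I * t) + s + 2).im| ≤ 2 * T + |s.im| := by
      simp
      exact (abs_add_le _ _).trans (by linarith)
    have hy : |s.im| ≤ 1 + s.im ^ 2 := by
      rw [← sq_abs s.im]; nlinarith [sq_nonneg (|s.im| - 1)]
    nlinarith [sq_nonneg s.im, mul_nonneg (by linarith : (0:ℝ) ≤ T - 2) (sq_nonneg s.im)]
  have hq0 : (0:ℝ) < q := by exact_mod_cast (by omega : 0 < q)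
  rw [norm_mul, norm_mul, norm_cpow_eq_rpow_re_of_pos hX]
  have hXp := Real.rpow_pos_of_pos hX s.re
  calc _ ≤ M / (1 + s.im ^ 2) ^ 2 * X ^ s.re * (C * q * (5 * T * (1 + s.im ^ 2))) := by
        gcongr
        exact b2.trans (by gcongr)
    _ = _ := by
        have : (1 + s.im ^ 2) ≠ 0 := by positivity
        field_simp

end SmoothedApprox

/-- Smoothed approximation to a Dirichlet `L`-function: for primitive `χ` mod `q ≥ 2`,
`σ ∈ [1/2,1]`, `|t| ≤ 2T`, one has
`L(σ+it,χ) = Σ_n χ(n) n^{−σ−it} e^{−n/(qT)²} + O((qT)^{−1+ε})`. -/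
theorem LFunction_smoothed_approx (ε : ℝ) (hε : 0 < ε) :
    ∃ C : ℝ, 0 < C ∧ ∀ (q : ℕ) [NeZero q], 2 ≤ q →
      ∀ χ : DirichletCharacter ℂ q, χ.IsPrimitive →
      ∀ σ t T : ℝ, 1 / 2 ≤ σ → σ ≤ 1 → 2 ≤ T → |t| ≤ 2 * T →
        ‖DirichletCharacter.LFunction χ ((σ : ℂ) + Complex.I * t) -
            ∑' n : ℕ, χ (n : ZMod q) * (n : ℂ) ^ (-((σ : ℂ) + Complex.I * t)) *
              (Real.exp (-((n : ℝ) / ((q : ℝ) * T) ^ 2)) : ℂ)‖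
          ≤ C * ((q : ℝ) * T) ^ (-1 + ε) := by
  obtain ⟨e, he, he4, heε⟩ : ∃ e : ℝ, 0 < e ∧ e ≤ 1 / 4 ∧ 2 * e ≤ ε :=
    ⟨min ε (1 / 2) / 2, by positivity, by linarith [min_le_right ε (1 / 2)],
      by linarith [min_le_left ε (1 / 2)]⟩
  obtain ⟨K, hK, hb⟩ := SmoothedApprox.pointwise he he4
  refine ⟨K, hK, ?_⟩
  intro q _ hq χ hχ σ t T h1 h2 hT ht
  have hq2 : (2:ℝ) ≤ q := by exact_mod_cast hq
  set Q : ℝ := q * T with hQ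
  have hQ4 : 4 ≤ Q := by rw [hQ]; nlinarith
  have hQ0 : 0 < Q := by linarith
  set X : ℝ := Q ^ 2 with hXd
  have hX : 0 < X := by positivity
  have hX1 : 1 ≤ X := by rw [hXd]; nlinarith
  obtain ⟨d, hd⟩ : ∃ d : ℝ, d = 1 - e := ⟨_, rfl⟩
  have hd0 : 0 < d := by linarith
  have hd1 : d < 1 := by linarith
  have hbs := hb q hq χ hχ σ t T X h1 h2 hT ht hX
  rw [← hQ, ← hd] at hbs
  set s₀ : ℂ := σ + I * t with hs₀
  have hXc : (X : ℂ) ≠ 0 := by exact_mod_cast hX.ne'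
  have hcont := SmoothedApprox.contour
    (G := fun s => Gamma (s + 1) * (X : ℂ) ^ s * DirichletCharacter.LFunction χ (s₀ + s))
    (d := d) (M := K * Q * X ^ d) hd0 ?_ ?_
  rotate_left
  · intro s hs1 hs2
    have g1 : DifferentiableAt ℂ (fun s => Gamma (s + 1)) s := by
      have : DifferentiableAt ℂ Gamma (s + 1) := by
        apply differentiableAt_Gamma
        intro m hm
        have := congrArg Complex.re hm
        simp at this
        have : (0:ℝ) ≤ m := m.cast_nonneg
        linarith
      exact this.comp s (by fun_prop)
    have g2 : DifferentiableAt ℂ (fun s => (X : ℂ) ^ s) s :=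
      differentiableAt_id.const_cpow (Or.inl hXc)
    have g3 : DifferentiableAt ℂ (fun s => DirichletCharacter.LFunction χ (s₀ + s)) s :=
      ((DirichletCharacter.differentiable_LFunction
        (SmoothedApprox.ne_one (by omega) hχ)) _).comp s (by fun_prop)
    exact (g1.mul g2).mul g3
  · intro s hs1 hs2
    refine (hbs s hs1 hs2).trans ?_
    gcongr
  rw [SmoothedApprox.right_line hq χ hd0 hd1 (by simp [hs₀]; linarith) hX] at hcont
  simp only [zero_add, Gamma_one, cpow_zero, one_mul, add_zero] at hcont
  set J : ℂ := ∫ y : ℝ, Gamma ((-d : ℝ) + y * I + 1) * (X : ℂ) ^ (((-d : ℝ) : ℂ) + y * I) *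
        DirichletCharacter.LFunction χ (s₀ + ((-d : ℝ) + y * I)) / ((-d : ℝ) + y * I) with hJ
  set A : ℂ := ∑' n : ℕ, χ (n : ZMod q) * (n : ℂ) ^ (-s₀) * (Real.exp (-((n : ℝ) / X)) : ℂ) with hA
  have hJb : ‖J‖ ≤ K * Q * X ^ (-d) / d * Real.pi := by
    rw [← integral_univ_inv_one_add_sq, ← MeasureTheory.integral_const_mul]
    refine MeasureTheory.norm_integral_le_of_norm_le (integrable_inv_one_add_sq.const_mul _)
      (Filter.Eventually.of_forall fun y => ?_)
    have hn : d ≤ ‖((-d : ℝ) : ℂ) + y * I‖ := by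
      have := Complex.abs_re_le_norm (((-d : ℝ) : ℂ) + y * I)
      simpa [abs_of_pos hd0] using this
    have h3 := hbs (((-d : ℝ) : ℂ) + y * I) (by simp) (by simp; linarith)
    have hre : (((-d : ℝ) : ℂ) + y * I).re = -d := by simp
    have him : (((-d : ℝ) : ℂ) + y * I).im = y := by simp
    rw [hre, him] at h3
    rw [norm_div, show K * Q * X ^ (-d) / d * (1 + y ^ 2)⁻¹ = (K * Q * X ^ (-d) / (1 + y ^ 2)) / d by
      field_simp]
    exact div_le_div₀ ((norm_nonneg _).trans h3) h3 hd0 hn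
  have hpi := Real.pi_pos
  have hpc : (Real.pi : ℂ) ≠ 0 := by exact_mod_cast hpi.ne'
  have hdiff : DirichletCharacter.LFunction χ s₀ - A = -J / (2 * Real.pi) := by
    field_simp
    linear_combination -hcont
  have hnorm : ‖(2 * Real.pi : ℂ)‖ = 2 * Real.pi := by
    simp [abs_of_pos hpi]
  rw [hdiff, norm_div, norm_neg, hnorm, div_le_iff₀ (by positivity)]
  refine hJb.trans ?_
  have hpow : Q * X ^ (-d) = Q ^ (-1 + 2 * e) := by
    rw [hXd, ← Real.rpow_natCast, ← Real.rpow_mul hQ0.le]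
    nth_rewrite 1 [← Real.rpow_one Q]
    rw [← Real.rpow_add hQ0, hd]
    congr 1
    push_cast
    ring
  have hle : Q ^ (-1 + 2 * e) ≤ Q ^ (-1 + ε) :=
    Real.rpow_le_rpow_of_exponent_le (by linarith) (by linarith)
  rw [mul_assoc K, hpow, div_mul_eq_mul_div, div_le_iff₀ hd0]
  have hpos : 0 < K * Q ^ (-1 + ε) * Real.pi := by positivity
  calc K * Q ^ (-1 + 2 * e) * Real.pi ≤ K * Q ^ (-1 + ε) * Real.pi := by gcongr
    _ ≤ K * Q ^ (-1 + ε) * (2 * Real.pi) * d := by nlinarith
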